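/- arXiv:2411.11037 — 2 statements merged into one kernel-verified Lean document; each statement's English description precedes it below -/
import Mathlib

section
/- Let 3/2<p<3, p<q<p+2p^2/3, a,b>0. Define i(c) = inf over u in W^{1,p}(ℝ^3) with |u|_p = c of I(u) = (a/p)|∇u|_p^p + (b/(2p))|∇u|_p^{2p} - (1/q)|u|_q^q. Then i(c) ≤ 0 for every c>0, and I is bounded from below on S(c), so i(c) is finite. -/
open MeasureTheory Real Set Filter

noncomputable section

abbrev E3 := EuclideanSpace ℝ (Fin 3)

def gradPow (p : ℝ) (u : E3 → ℝ) : ℝ := ∫ x : E3, ‖fderiv ℝ u x‖ ^ p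
def lpPow (s : ℝ) (u : E3 → ℝ) : ℝ := ∫ x : E3, |u x| ^ s
def Wmem (p : ℝ) (u : E3 → ℝ) : Prop :=
  Differentiable ℝ u ∧ MeasureTheory.Integrable (fun x : E3 => |u x| ^ p) ∧
    MeasureTheory.Integrable (fun x : E3 => ‖fderiv ℝ u x‖ ^ p)
def Ifun (a b p q : ℝ) (u : E3 → ℝ) : ℝ :=
  a / p * gradPow p u + b / (2 * p) * (gradPow p u) ^ 2 - 1 / q * lpPow q u
def Sset (p c : ℝ) : Set (E3 → ℝ) := {u | Wmem p u ∧ lpPow p u = c ^ p}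
def ifun (a b p q c : ℝ) : ℝ := sInf (Ifun a b p q '' Sset p c)

section Sobolev

open scoped ENNReal NNReal
open Function Finset Measure Module

/-- A differentiable compactly supported function on `ℝ` is bounded by the integral of its derivative,
even when the derivative is not continuous. -/
theorem HasCompactSupport.enorm_le_lintegral_Iic_deriv_of_differentiable
    {f : ℝ → ℝ} (hf : Differentiable ℝ f) (hfs : HasCompactSupport f) (x : ℝ) :
    ‖f x‖ₑ ≤ ∫⁻ y in Iic x, ‖deriv f y‖ₑ := by
  by_cases hfin : ∫⁻ y in Iic x, ‖deriv f y‖ₑ = ∞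
  · simp [hfin]
  have hint : IntegrableOn (deriv f) (Iic x) :=
    ⟨(measurable_deriv f).aestronglyMeasurable, lt_top_iff_ne_top.2 hfin⟩
  have hlim : Tendsto f atBot (nhds 0) := by
    rw [hasCompactSupport_iff_eventuallyEq, Filter.coclosedCompact_eq_cocompact] at hfs
    exact (hfs.filter_mono atBot_le_cocompact).tendsto
  have := integral_Iic_of_hasDerivAt_of_tendsto' (fun y _ ↦ (hf y).hasDerivAt) hint hlim
  rw [sub_zero] at this
  rw [← this]
  exact enorm_integral_le_lintegral_enorm _

/-- Version of `lintegral_pow_le_pow_lintegral_fderiv_aux` for functions that are merely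
differentiable. -/
theorem lintegral_pow_le_pow_lintegral_fderiv_pi_of_differentiable {ι : Type*} [Fintype ι]
    {p : ℝ} (hp : Real.HolderConjugate (Fintype.card ι) p)
    {u : (ι → ℝ) → ℝ} (hu : Differentiable ℝ u)
    (h2u : HasCompactSupport u) :
    ∫⁻ x, ‖u x‖ₑ ^ p ≤ (∫⁻ x, ‖fderiv ℝ u x‖ₑ) ^ p := by
  classical
  have : (1 : ℝ) ≤ ↑(Fintype.card ι) - 1 := by
    have hι : (2 : ℝ) ≤ Fintype.card ι := by exact_mod_cast hp.lt
    linarith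
  calc ∫⁻ x, ‖u x‖ₑ ^ p
      = ∫⁻ x, (‖u x‖ₑ ^ (1 / (Fintype.card ι - 1 : ℝ))) ^ (Fintype.card ι : ℝ) := by
        congr! 2 with x
        rw [← ENNReal.rpow_mul, hp.conjugate_eq]
        field_simp
    _ = ∫⁻ x, ∏ _i : ι, ‖u x‖ₑ ^ (1 / (Fintype.card ι - 1 : ℝ)) := by
        congr! 2 with x
        simp_rw [prod_const]
        norm_cast
    _ ≤ ∫⁻ x, ∏ i, (∫⁻ xᵢ, ‖fderiv ℝ u (update x i xᵢ)‖ₑ) ^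
          ((1 : ℝ) / (Fintype.card ι - 1 : ℝ)) := ?_
    _ ≤ (∫⁻ x, ‖fderiv ℝ u x‖ₑ) ^ p := by
        apply lintegral_prod_lintegral_pow_le _ hp
        fun_prop
  gcongr with x i
  calc ‖u x‖ₑ
    _ ≤ ∫⁻ xᵢ in Iic (x i), ‖deriv (u ∘ update x i) xᵢ‖ₑ := by
        apply le_trans (by simp)
          (HasCompactSupport.enorm_le_lintegral_Iic_deriv_of_differentiable _ _ _)
        · exact hu.comp fun t ↦ (hasDerivAt_update x i t).differentiableAt
        · exact h2u.comp_isClosedEmbedding (isClosedEmbedding_update x i)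
    _ ≤ ∫⁻ xᵢ, ‖fderiv ℝ u (update x i xᵢ)‖ₑ := ?_
  gcongr with y
  · exact Measure.restrict_le_self
  calc ‖deriv (u ∘ update x i) y‖ₑ = ‖fderiv ℝ u (update x i y) (deriv (update x i) y)‖ₑ := by
        rw [fderiv_comp_deriv _ hu.differentiableAt
          (hasDerivAt_update x i y).differentiableAt]
    _ ≤ ‖fderiv ℝ u (update x i y)‖ₑ * ‖deriv (update x i) y‖ₑ :=
        ContinuousLinearMap.le_opENorm _ _
    _ ≤ ‖fderiv ℝ u (update x i y)‖ₑ := by simp [deriv_update, Pi.enorm_single]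

variable {E : Type*} [NormedAddCommGroup E] [NormedSpace ℝ E] [MeasurableSpace E] [BorelSpace E]
  [FiniteDimensional ℝ E] (μ : Measure E) [IsAddHaarMeasure μ]

theorem lintegral_pow_le_pow_lintegral_fderiv_of_differentiable {u : E → ℝ}
    (hu : Differentiable ℝ u) (h2u : HasCompactSupport u)
    {p : ℝ} (hp : Real.HolderConjugate (finrank ℝ E) p) :
    ∫⁻ x, ‖u x‖ₑ ^ p ∂μ ≤
      lintegralPowLePowLIntegralFDerivConst μ p * (∫⁻ x, ‖fderiv ℝ u x‖ₑ ∂μ) ^ p := by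
  set C := lintegralPowLePowLIntegralFDerivConst μ p
  let ι := Fin (finrank ℝ E)
  have hιcard : Fintype.card ι = finrank ℝ E := Fintype.card_fin (finrank ℝ E)
  have : finrank ℝ E = finrank ℝ (ι → ℝ) := by simp [hιcard]
  let e : E ≃L[ℝ] ι → ℝ := ContinuousLinearEquiv.ofFinrankEq this
  have hp : Real.HolderConjugate (Fintype.card ι) p := by rwa [hιcard]
  have h0p : 0 ≤ p := hp.symm.nonneg
  let c := addHaarScalarFactor μ ((volume : Measure (ι → ℝ)).map e.symm)
  have hc : 0 < c := addHaarScalarFactor_pos_of_isAddHaarMeasure ..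
  have h2c : μ = c • ((volume : Measure (ι → ℝ)).map e.symm) := isAddLeftInvariant_eq_smul ..
  have h3c : (c : ℝ≥0∞) ≠ 0 := by simp_rw [ne_eq, ENNReal.coe_eq_zero, hc.ne', not_false_eq_true]
  have h0C : C = (c * ‖(e.symm : (ι → ℝ) →L[ℝ] E)‖₊ ^ p) * (c ^ p)⁻¹ := by
    simp_rw [c, ι, C, e, lintegralPowLePowLIntegralFDerivConst]
  have hC : C * c ^ p = c * ‖(e.symm : (ι → ℝ) →L[ℝ] E)‖₊ ^ p := by
    rw [h0C, inv_mul_cancel_right₀ (NNReal.rpow_pos hc).ne']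
  simp only [h2c, ENNReal.smul_def, lintegral_smul_measure, smul_eq_mul]
  let v : (ι → ℝ) → ℝ := u ∘ e.symm
  have hv : Differentiable ℝ v := hu.comp e.symm.differentiable
  have h2v : HasCompactSupport v := h2u.comp_homeomorph e.symm.toHomeomorph
  have :=
  calc ∫⁻ x, ‖u x‖ₑ ^ p ∂(volume : Measure (ι → ℝ)).map e.symm
      = ∫⁻ y, ‖v y‖ₑ ^ p := by
        refine lintegral_map ?_ e.symm.continuous.measurable
        exact hu.continuous.measurable.nnnorm.coe_nnreal_ennreal.pow_const _
    _ ≤ (∫⁻ y, ‖fderiv ℝ v y‖ₑ) ^ p :=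
        lintegral_pow_le_pow_lintegral_fderiv_pi_of_differentiable hp hv h2v
    _ = (∫⁻ y, ‖(fderiv ℝ u (e.symm y)).comp (fderiv ℝ e.symm y)‖ₑ) ^ p := by
        congr! with y
        apply fderiv_comp _ (hu _)
        exact e.symm.differentiableAt
    _ ≤ (∫⁻ y, ‖fderiv ℝ u (e.symm y)‖ₑ * ‖(e.symm : (ι → ℝ) →L[ℝ] E)‖ₑ) ^ p := by
        gcongr with y
        rw [e.symm.fderiv]
        apply ContinuousLinearMap.opENorm_comp_le
    _ = (‖(e.symm : (ι → ℝ) →L[ℝ] E)‖ₑ * ∫⁻ y, ‖fderiv ℝ u (e.symm y)‖ₑ) ^ p := by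
        rw [lintegral_mul_const, mul_comm]
        fun_prop
    _ = (‖(e.symm : (ι → ℝ) →L[ℝ] E)‖₊ ^ p : ℝ≥0) * (∫⁻ y, ‖fderiv ℝ u (e.symm y)‖ₑ) ^ p := by
        rw [ENNReal.mul_rpow_of_nonneg _ _ h0p, enorm_eq_nnnorm, ← ENNReal.coe_rpow_of_nonneg _ h0p]
    _ = (‖(e.symm : (ι → ℝ) →L[ℝ] E)‖₊ ^ p : ℝ≥0)
        * (∫⁻ x, ‖fderiv ℝ u x‖ₑ ∂(volume : Measure (ι → ℝ)).map e.symm) ^ p := by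
        congr
        rw [lintegral_map _ e.symm.continuous.measurable]
        fun_prop
  rw [← ENNReal.mul_le_mul_iff_right h3c ENNReal.coe_ne_top, ← mul_assoc, ← ENNReal.coe_mul, ← hC,
    ENNReal.coe_mul] at this
  rw [ENNReal.mul_rpow_of_nonneg _ _ h0p, ← mul_assoc, ← ENNReal.coe_rpow_of_ne_zero hc.ne']
  exact this

theorem eLpNorm_le_eLpNorm_fderiv_one_of_differentiable {u : E → ℝ}
    (hu : Differentiable ℝ u) (h2u : HasCompactSupport u) {p : ℝ≥0} (hp : NNReal.HolderConjugate (finrank ℝ E) p) :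
    eLpNorm u p μ ≤ eLpNormLESNormFDerivOneConst μ p * eLpNorm (fderiv ℝ u) 1 μ := by
  have h0p : 0 < (p : ℝ) := hp.coe.symm.pos
  rw [eLpNorm_one_eq_lintegral_enorm,
    ← ENNReal.rpow_le_rpow_iff h0p, ENNReal.mul_rpow_of_nonneg _ _ h0p.le,
    ← ENNReal.coe_rpow_of_nonneg _ h0p.le, eLpNormLESNormFDerivOneConst, ← NNReal.rpow_mul,
    eLpNorm_nnreal_pow_eq_lintegral hp.symm.pos.ne',
    inv_mul_cancel₀ h0p.ne', NNReal.rpow_one]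
  exact lintegral_pow_le_pow_lintegral_fderiv_of_differentiable μ hu h2u hp.coe

/-- Version of `eLpNorm_le_eLpNorm_fderiv_of_eq_inner` for functions that are merely differentiable. -/
theorem eLpNorm_le_eLpNorm_fderiv_of_eq_inner_of_differentiable {u : E → ℝ}
    (hu : Differentiable ℝ u) (h2u : HasCompactSupport u)
    {p p' : ℝ≥0} (hp : 1 ≤ p) (hn : 0 < finrank ℝ E)
    (hp' : (p' : ℝ)⁻¹ = p⁻¹ - (finrank ℝ E : ℝ)⁻¹) :
    eLpNorm u p' μ ≤ eLpNormLESNormFDerivOfEqInnerConst μ p * eLpNorm (fderiv ℝ u) p μ := by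
  by_cases hp'0 : p' = 0
  · simp [hp'0]
  set n := finrank ℝ E
  let n' := NNReal.conjExponent n
  have h2p : (p : ℝ) < n := by
    have : 0 < p⁻¹ - (n : ℝ)⁻¹ :=
      NNReal.coe_lt_coe.mpr (pos_iff_ne_zero.mpr (inv_ne_zero hp'0)) |>.trans_eq hp'
    rwa [NNReal.coe_inv, sub_pos,
      inv_lt_inv₀ _ (zero_lt_one.trans_le (NNReal.coe_le_coe.mpr hp))] at this
    exact_mod_cast hn
  have h0n : 2 ≤ n := Nat.succ_le_of_lt <| Nat.one_lt_cast.mp <| hp.trans_lt h2p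
  have hn : NNReal.HolderConjugate n n' := .conjExponent (by norm_cast)
  have h1n : 1 ≤ (n : ℝ≥0) := hn.lt.le
  have h2n : (0 : ℝ) < n - 1 := by simp_rw [sub_pos]; exact hn.coe.lt
  have hnp : (0 : ℝ) < n - p := by simp_rw [sub_pos]; exact h2p
  rcases hp.eq_or_lt with rfl | hp
  · convert! eLpNorm_le_eLpNorm_fderiv_one_of_differentiable μ hu h2u hn using 2
    · suffices (p' : ℝ) = n' by simpa using this
      rw [← inv_inj, hp']
      simp [field, n', NNReal.conjExponent, *]
    · norm_cast
      simp_rw [n', n, eLpNormLESNormFDerivOfEqInnerConst]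
      simp only [n, NNReal.coe_one] at hnp
      field_simp
      simp
  let q := Real.conjExponent p
  have hq : Real.HolderConjugate p q := .conjExponent hp
  have h0p : p ≠ 0 := zero_lt_one.trans hp |>.ne'
  have h1p : (p : ℝ) ≠ 1 := hq.lt.ne'
  have h3p : (p : ℝ) - 1 ≠ 0 := sub_ne_zero_of_ne h1p
  have h2q : 1 / n' - 1 / q = 1 / p' := by
    simp_rw -zeta [one_div, hp']
    rw [← hq.one_sub_inv, ← hn.coe.one_sub_inv, sub_sub_sub_cancel_left]
    simp only [NNReal.coe_natCast, NNReal.coe_inv]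
  let γ : ℝ≥0 := .mk (p * (n - 1) / (n - p)) (by positivity)
  have h0γ : (γ : ℝ) = p * (n - 1) / (n - p) := rfl
  have h1γ : 1 < (γ : ℝ) := by
    rwa [h0γ, one_lt_div hnp, mul_sub, mul_one, sub_lt_sub_iff_right, lt_mul_iff_one_lt_left]
    exact hn.coe.pos
  have h2γ : γ * n' = p' := by
    rw [← NNReal.coe_inj, ← inv_inj, hp', NNReal.coe_mul, h0γ, hn.coe.conjugate_eq]
    simp [field]
  have h3γ : (γ - 1) * q = p' := by
    rw [← inv_inj, hp', h0γ, hq.conjugate_eq]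
    have : (p : ℝ) * (n - 1) - (n - p) = n * (p - 1) := by ring
    simp [field, this]
  have h4γ : (γ : ℝ) ≠ 0 := (zero_lt_one.trans h1γ).ne'
  by_cases h3u : ∫⁻ x, ‖u x‖ₑ ^ (p' : ℝ) ∂μ = 0
  · rw [eLpNorm_nnreal_eq_lintegral hp'0, h3u, ENNReal.zero_rpow_of_pos] <;> positivity
  have h4u : ∫⁻ x, ‖u x‖ₑ ^ (p' : ℝ) ∂μ ≠ ∞ := by
    refine lintegral_rpow_enorm_lt_top_of_eLpNorm'_lt_top
      ((NNReal.coe_pos.trans pos_iff_ne_zero).mpr hp'0) ?_ |>.ne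
    rw [← eLpNorm_nnreal_eq_eLpNorm' hp'0]
    exact hu.continuous.memLp_of_hasCompactSupport (μ := μ) h2u |>.eLpNorm_lt_top
  have h5u : (∫⁻ x, ‖u x‖ₑ ^ (p' : ℝ) ∂μ) ^ (1 / q) ≠ 0 :=
    ENNReal.rpow_pos (pos_iff_ne_zero.mpr h3u) h4u |>.ne'
  have h6u : (∫⁻ x, ‖u x‖ₑ ^ (p' : ℝ) ∂μ) ^ (1 / q) ≠ ∞ := by finiteness
  have h7u := hu.continuous
  let v : E → ℝ := fun x ↦ ‖u x‖ ^ (γ : ℝ)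
  have hv : Differentiable ℝ v := hu.norm_rpow h1γ
  have h2v : HasCompactSupport v := h2u.norm.rpow_const h4γ
  set C := eLpNormLESNormFDerivOneConst μ n'
  have :=
  calc (∫⁻ x, ‖u x‖ₑ ^ (p' : ℝ) ∂μ) ^ (1 / (n' : ℝ)) = eLpNorm v n' μ := by
        rw [← h2γ, eLpNorm_nnreal_eq_lintegral hn.symm.pos.ne']
        simp (discharger := positivity) [v, Real.enorm_rpow_of_nonneg, ENNReal.rpow_mul]
    _ ≤ C * eLpNorm (fderiv ℝ v) 1 μ := eLpNorm_le_eLpNorm_fderiv_one_of_differentiable μ hv h2v hn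
    _ = C * ∫⁻ x, ‖fderiv ℝ v x‖ₑ ∂μ := by rw [eLpNorm_one_eq_lintegral_enorm]
    _ ≤ C * γ * ∫⁻ x, ‖u x‖ₑ ^ ((γ : ℝ) - 1) * ‖fderiv ℝ u x‖ₑ ∂μ := by
      rw [mul_assoc, ← lintegral_const_mul γ]
      · gcongr
        simp_rw [← mul_assoc]
        exact enorm_fderiv_norm_rpow_le hu h1γ
      dsimp [enorm]
      fun_prop
    _ ≤ C * γ * ((∫⁻ x, ‖u x‖ₑ ^ (p' : ℝ) ∂μ) ^ (1 / q) *
        (∫⁻ x, ‖fderiv ℝ u x‖ₑ ^ (p : ℝ) ∂μ) ^ (1 / (p : ℝ))) := by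
        gcongr
        convert!
          ENNReal.lintegral_mul_le_Lp_mul_Lq μ (.symm <| .conjExponent <| show 1 < (p : ℝ) from hp)
            ?_ ?_ using 5
        · simp [γ, n, q, ← ENNReal.rpow_mul, ← h3γ]
        · fun_prop
        · fun_prop
    _ = C * γ * (∫⁻ x, ‖fderiv ℝ u x‖ₑ ^ (p : ℝ) ∂μ) ^ (1 / (p : ℝ)) *
      (∫⁻ x, ‖u x‖ₑ ^ (p' : ℝ) ∂μ) ^ (1 / q) := by ring
  calc
    eLpNorm u p' μ
      = (∫⁻ x, ‖u x‖ₑ ^ (p' : ℝ) ∂μ) ^ (1 / (p' : ℝ)) := eLpNorm_nnreal_eq_lintegral hp'0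
    _ ≤ C * γ * (∫⁻ x, ‖fderiv ℝ u x‖ₑ ^ (p : ℝ) ∂μ) ^ (1 / (p : ℝ)) := by
      rwa [← h2q, ENNReal.rpow_sub _ _ h3u h4u, ENNReal.div_le_iff h5u h6u]
    _ = eLpNormLESNormFDerivOfEqInnerConst μ p * eLpNorm (fderiv ℝ u) (↑p) μ := by
      suffices (C : ℝ) * γ = eLpNormLESNormFDerivOfEqInnerConst μ p by
        rw [eLpNorm_nnreal_eq_lintegral h0p]
        congr
        norm_cast at this ⊢
      simp_rw [eLpNormLESNormFDerivOfEqInnerConst, γ]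
      refold_let n n' C
      rw [NNReal.coe_mul, NNReal.coe_mk, Real.coe_toNNReal', mul_eq_mul_left_iff, eq_comm,
        max_eq_left_iff]
      left
      positivity

/-- The Sobolev inequality for differentiable functions without a support condition. -/
theorem eLpNorm_le_eLpNorm_fderiv_add_eLpNorm
    {p p' : ℝ≥0} (hp : 1 ≤ p) (hn : 0 < finrank ℝ E)
    (hp' : (p' : ℝ)⁻¹ = p⁻¹ - (finrank ℝ E : ℝ)⁻¹) :
    ∃ C : ℝ≥0, ∀ u : E → ℝ, Differentiable ℝ u →
      eLpNorm u p' μ ≤ C * (eLpNorm (fderiv ℝ u) p μ + eLpNorm u p μ) := by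
  let φ : ContDiffBump (0 : E) := ⟨1, 2, one_pos, one_lt_two⟩
  have hφ1 : ContDiff ℝ 1 φ := φ.contDiff
  have hφd : Differentiable ℝ φ := hφ1.differentiable one_ne_zero
  obtain ⟨M, hM⟩ : ∃ M, ∀ x, ‖fderiv ℝ φ x‖ ≤ M :=
    (φ.hasCompactSupport.fderiv (𝕜 := ℝ)).exists_bound_of_continuous
      (hφ1.continuous_fderiv one_ne_zero)
  have hM0 : 0 ≤ M := (norm_nonneg _).trans (hM 0)
  let K : ℝ≥0 := eLpNormLESNormFDerivOfEqInnerConst μ p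
  let N : ℝ≥0 := ⟨M, hM0⟩
  refine ⟨K * (1 + N), fun u hu ↦ ?_⟩
  let w : ℕ → E → ℝ := fun k x ↦ φ ((k + 1 : ℝ)⁻¹ • x) * u x
  have hχ (k : ℕ) (x : E) : HasFDerivAt (fun x : E ↦ φ ((k + 1 : ℝ)⁻¹ • x))
      ((k + 1 : ℝ)⁻¹ • fderiv ℝ φ ((k + 1 : ℝ)⁻¹ • x)) x := by
    have h1 : HasFDerivAt (fun x : E ↦ (k + 1 : ℝ)⁻¹ • x)
        ((k + 1 : ℝ)⁻¹ • ContinuousLinearMap.id ℝ E) x := (hasFDerivAt_id x).const_smul _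
    refine ((hφd ((k + 1 : ℝ)⁻¹ • x)).hasFDerivAt.comp x h1).congr_fderiv ?_
    ext y
    simp
  have hw (k : ℕ) (x : E) : HasFDerivAt (w k) (φ ((k + 1 : ℝ)⁻¹ • x) • fderiv ℝ u x +
      u x • (k + 1 : ℝ)⁻¹ • fderiv ℝ φ ((k + 1 : ℝ)⁻¹ • x)) x := (hχ k x).mul (hu x).hasFDerivAt
  have hwd (k : ℕ) : Differentiable ℝ (w k) := fun x ↦ (hw k x).differentiableAt
  have hwc (k : ℕ) : HasCompactSupport (w k) := by
    refine HasCompactSupport.mul_right ?_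
    exact φ.hasCompactSupport.comp_homeomorph
      (Homeomorph.smulOfNeZero ((k + 1 : ℝ)⁻¹) (by positivity))
  have hbound (k : ℕ) (x : E) : ‖fderiv ℝ (w k) x‖ ≤ ‖fderiv ℝ u x‖ + M * ‖u x‖ := by
    have h1 : ((k : ℝ) + 1)⁻¹ ≤ 1 := inv_le_one_of_one_le₀ (by simp)
    have h2 : ‖φ ((k + 1 : ℝ)⁻¹ • x)‖ ≤ 1 := by
      rw [Real.norm_of_nonneg φ.nonneg]; exact φ.le_one
    rw [(hw k x).fderiv]
    refine (norm_add_le _ _).trans ?_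
    rw [norm_smul, norm_smul, norm_smul, norm_inv,
      Real.norm_of_nonneg (by positivity : (0 : ℝ) ≤ k + 1)]
    rw [mul_comm M]
    gcongr
    · exact mul_le_of_le_one_left (norm_nonneg _) h2
    · exact (mul_le_of_le_one_left (norm_nonneg _) h1).trans (hM _)
  have hwle (k : ℕ) : eLpNorm (w k) p' μ
      ≤ (K * (1 + N) : ℝ≥0) * (eLpNorm (fderiv ℝ u) p μ + eLpNorm u p μ) := by
    calc eLpNorm (w k) p' μ ≤ K * eLpNorm (fderiv ℝ (w k)) p μ :=
          eLpNorm_le_eLpNorm_fderiv_of_eq_inner_of_differentiable μ (hwd k) (hwc k) hp hn hp'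
      _ ≤ K * (eLpNorm (fderiv ℝ u) p μ + N * eLpNorm u p μ) := by
          gcongr
          have h1 : eLpNorm (fderiv ℝ (w k)) p μ
              ≤ eLpNorm ((fun x ↦ ‖fderiv ℝ u x‖) + fun x ↦ M * ‖u x‖) p μ :=
            eLpNorm_mono_real (hbound k)
          refine h1.trans ((eLpNorm_add_le ?_ ?_ (by exact_mod_cast hp)).trans ?_)
          · exact (measurable_fderiv ℝ u).norm.aestronglyMeasurable
          · exact (hu.continuous.norm.const_mul M).aestronglyMeasurable
          rw [eLpNorm_norm]
          gcongr
          have := eLpNorm_const_smul (μ := μ) M (fun x ↦ ‖u x‖) (p := p)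
          rw [eLpNorm_norm] at this
          refine this.le.trans_eq ?_
          congr 1
          rw [Real.enorm_of_nonneg hM0]
          exact ENNReal.ofReal_eq_coe_nnreal hM0
      _ ≤ K * ((1 + N) * eLpNorm (fderiv ℝ u) p μ + (1 + N) * eLpNorm u p μ) := by
          gcongr
          · exact le_mul_of_one_le_left zero_le (le_add_right le_rfl)
          · exact le_add_left le_rfl
      _ = _ := by push_cast; ring
  have hlim (x : E) : Tendsto (fun k ↦ w k x) atTop (nhds (u x)) := by
    have h0 : Tendsto (fun k : ℕ ↦ φ ((k + 1 : ℝ)⁻¹ • x)) atTop (nhds (φ ((0 : ℝ) • x))) := by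
      refine (φ.continuous.tendsto _).comp (Tendsto.smul_const ?_ x)
      simpa using tendsto_one_div_add_atTop_nhds_zero_nat (𝕜 := ℝ)
    have h1 : φ ((0 : ℝ) • x) = 1 :=
      φ.one_of_mem_closedBall (by simpa using φ.rIn_pos.le)
    rw [h1] at h0
    simpa [w] using h0.mul_const (u x)
  refine (Lp.eLpNorm_lim_le_liminf_eLpNorm (fun k ↦ (hwd k).continuous.aestronglyMeasurable) u
    (ae_of_all _ hlim)).trans ?_
  exact (liminf_le_liminf (Eventually.of_forall hwle)).trans_eq (liminf_const _)

end Sobolev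

theorem ENNReal.lintegral_rpow_le_of_exponent_eq {α : Type*} [MeasurableSpace α] {μ : Measure α}
    {f : α → ENNReal} (hf : AEMeasurable f μ) {s t l : ℝ} (hs : 0 ≤ s) (ht : 0 ≤ t)
    (hl0 : 0 ≤ l) (hl1 : l ≤ 1) :
    ∫⁻ x, f x ^ (s * (1 - l) + t * l) ∂μ
      ≤ (∫⁻ x, f x ^ s ∂μ) ^ (1 - l) * (∫⁻ x, f x ^ t ∂μ) ^ l := by
  have h1l : 0 ≤ 1 - l := sub_nonneg.2 hl1
  refine le_trans (le_of_eq ?_) (ENNReal.lintegral_mul_norm_pow_le (hf.pow_const s)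
    (hf.pow_const t) h1l hl0 (by ring))
  congr 1 with x
  rw [ENNReal.rpow_add_of_nonneg _ _ (mul_nonneg hs h1l) (mul_nonneg ht hl0), ENNReal.rpow_mul,
    ENNReal.rpow_mul]

theorem eLpNorm_toNNReal_eq_ofReal {F : Type*} [NormedAddCommGroup F] {f : E3 → F} {p : ℝ}
    (hp : 0 < p) (hf : AEStronglyMeasurable f) (hi : Integrable fun x ↦ ‖f x‖ ^ p) :
    eLpNorm f p.toNNReal volume = ENNReal.ofReal ((∫ x, ‖f x‖ ^ p) ^ p⁻¹) := by
  have hp0 : (p.toNNReal : ENNReal) ≠ 0 := by simpa using hp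
  have hpr : (p.toNNReal : ENNReal).toReal = p := by simp [hp.le]
  have hm : MemLp f p.toNNReal volume := by
    rw [← integrable_norm_rpow_iff hf hp0 ENNReal.coe_ne_top, hpr]
    exact hi
  rw [hm.eLpNorm_eq_integral_rpow_norm hp0 ENNReal.coe_ne_top, hpr]

theorem lpPow_eq_toReal_lintegral {u : E3 → ℝ} (hu : Measurable u) {s : ℝ} (hs : 0 ≤ s) :
    lpPow s u = (∫⁻ x, ‖u x‖ₑ ^ s).toReal := by
  rw [lpPow, integral_eq_lintegral_of_nonneg_ae (ae_of_all _ fun x ↦ by positivity)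
    (by fun_prop)]
  congr 2 with x
  rw [← Real.norm_eq_abs, ← ENNReal.ofReal_rpow_of_nonneg (norm_nonneg _) hs, ofReal_norm]

/-- A Gagliardo–Nirenberg type bound on the sphere `Sset p c`. -/
theorem exists_lpPow_le_gradPow {p q c : ℝ} (hp1 : 1 ≤ p) (hp2 : p < 3) (hc : 0 < c)
    (hq1 : p < q) (hq2 : q ≤ 3 * p / (3 - p)) :
    ∃ A : ℝ, 0 ≤ A ∧ ∀ u ∈ Sset p c,
      lpPow q u ≤ A * (gradPow p u ^ p⁻¹ + c) ^ (3 * (q - p) / p) := by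
  have hp0 : 0 < p := by linarith
  have h3p : 0 < 3 - p := by linarith
  set t : ℝ := 3 * p / (3 - p) with ht_def
  have ht0 : 0 < t := by positivity
  have htp : t - p = p ^ 2 / (3 - p) := by rw [ht_def]; field_simp; ring
  have htp0 : 0 < t - p := by rw [htp]; positivity
  set l : ℝ := (q - p) / (t - p) with hl_def
  have hl0 : 0 ≤ l := div_nonneg (by linarith) htp0.le
  have hl1 : l ≤ 1 := (div_le_one htp0).2 (by linarith)
  have hq : p * (1 - l) + t * l = q := by
    have : l * (t - p) = q - p := div_mul_cancel₀ _ htp0.ne'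
    linarith
  have hr : t * l = 3 * (q - p) / p := by
    rw [hl_def, htp, ht_def]; field_simp
  obtain ⟨C, hC⟩ := eLpNorm_le_eLpNorm_fderiv_add_eLpNorm (E := E3) volume
    (p := p.toNNReal) (p' := t.toNNReal) (by simpa using hp1) (by simp)
    (by
      rw [NNReal.coe_inv, Real.coe_toNNReal _ ht0.le, Real.coe_toNNReal _ hp0.le, ht_def]
      simp only [finrank_euclideanSpace, Fintype.card_fin]
      field_simp
      ring)
  refine ⟨(c ^ p) ^ (1 - l) * (C : ℝ) ^ (t * l), by positivity, fun u ⟨⟨hu, hup, hgp⟩, huc⟩ ↦ ?_⟩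
  have hG : 0 ≤ gradPow p u := integral_nonneg fun x ↦ by positivity
  have hcp : (0 : ℝ) < c ^ p := by positivity
  have hum : Measurable u := hu.continuous.measurable
  set y : ℝ := gradPow p u ^ p⁻¹ + c with hy_def
  have hy : 0 ≤ y := by positivity
  have hun : eLpNorm u p.toNNReal volume = ENNReal.ofReal c := by
    rw [eLpNorm_toNNReal_eq_ofReal hp0 hu.continuous.aestronglyMeasurable hup]
    change ENNReal.ofReal (lpPow p u ^ p⁻¹) = _
    rw [huc, Real.rpow_rpow_inv hc.le hp0.ne']
  have hgn : eLpNorm (fderiv ℝ u) p.toNNReal volume = ENNReal.ofReal (gradPow p u ^ p⁻¹) :=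
    eLpNorm_toNNReal_eq_ofReal hp0 (measurable_fderiv ℝ u).aestronglyMeasurable hgp
  have hS : ∫⁻ x, ‖u x‖ₑ ^ t ≤ ENNReal.ofReal ((C * y) ^ t) := by
    have h := hC u hu
    rw [hun, hgn, ← ENNReal.ofReal_add (by positivity) hc.le, ← ENNReal.ofReal_coe_nnreal (p := C),
      ← ENNReal.ofReal_mul C.coe_nonneg] at h
    have h' := ENNReal.rpow_le_rpow h ht0.le
    rw [ENNReal.ofReal_rpow_of_nonneg (by positivity) ht0.le] at h'
    convert h' using 1
    have := eLpNorm_nnreal_pow_eq_lintegral (f := u) (μ := volume) (p := t.toNNReal)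
      (by simpa using ht0)
    rw [Real.coe_toNNReal _ ht0.le] at this
    exact this.symm
  have hP : ∫⁻ x, ‖u x‖ₑ ^ p = ENNReal.ofReal (c ^ p) := by
    have h := lpPow_eq_toReal_lintegral hum hp0.le
    rw [huc] at h
    rw [h, ENNReal.ofReal_toReal]
    intro htop
    rw [htop, ENNReal.toReal_top] at h
    exact hcp.ne' h
  have hI := ENNReal.lintegral_rpow_le_of_exponent_eq (μ := volume) hum.enorm.aemeasurable
    hp0.le ht0.le hl0 hl1
  rw [hq, hP] at hI
  have hfin : ∫⁻ x, ‖u x‖ₑ ^ q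
      ≤ ENNReal.ofReal ((c ^ p) ^ (1 - l) * ((C * y) ^ t) ^ l) := by
    refine hI.trans ?_
    rw [ENNReal.ofReal_mul (by positivity), ENNReal.ofReal_rpow_of_pos hcp,
      ← ENNReal.ofReal_rpow_of_nonneg (by positivity) hl0]
    gcongr
  rw [lpPow_eq_toReal_lintegral hum (by linarith)]
  refine (ENNReal.toReal_le_of_le_ofReal (by positivity) hfin).trans_eq ?_
  rw [← Real.rpow_mul (mul_nonneg C.coe_nonneg hy) t l, Real.mul_rpow C.coe_nonneg hy, ← hr, mul_assoc]

theorem bddBelow_mul_sq_sub_mul_rpow {e A s : ℝ} (he : 0 < e) (hA : 0 ≤ A) (hs0 : 0 ≤ s)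
    (hs2 : s < 2) : ∃ B : ℝ, ∀ x : ℝ, 0 ≤ x → B ≤ e * x ^ 2 - A * x ^ s := by
  set M : ℝ := (A / e) ^ (2 - s)⁻¹ with hM
  have hM0 : 0 ≤ M := by positivity
  refine ⟨-(A * M ^ s), fun x hx ↦ ?_⟩
  rcases le_total x M with h | h
  · have : x ^ s ≤ M ^ s := Real.rpow_le_rpow hx h hs0
    nlinarith [mul_le_mul_of_nonneg_left this hA, sq_nonneg x]
  · have h1 : A / e ≤ x ^ (2 - s) := by
      have h2 := Real.rpow_le_rpow hM0 h (by linarith : (0 : ℝ) ≤ 2 - s)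
      rwa [hM, Real.rpow_inv_rpow (by positivity) (by linarith)] at h2
    have h3 : A ≤ e * x ^ (2 - s) := by rwa [div_le_iff₀' he] at h1
    have h4 : x ^ (2 - s) * x ^ s = x ^ 2 := by
      rw [← Real.rpow_add' hx (by norm_num), sub_add_cancel, Real.rpow_two]
    have h5 : A * x ^ s ≤ e * x ^ 2 := by
      rw [← h4, ← mul_assoc]
      gcongr
    have : 0 ≤ A * M ^ s := by positivity
    linarith

theorem bddBelow_Ifun_image {a b p q c : ℝ} (ha : 0 < a) (hb : 0 < b) (hc : 0 < c)
    (hp1 : 3 / 2 < p) (hp2 : p < 3) (hq1 : p < q) (hq2 : q < p + 2 * p ^ 2 / 3) :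
    BddBelow (Ifun a b p q '' Sset p c) := by
  have hp0 : 0 < p := by linarith
  have hq0 : 0 < q := by linarith
  have hq3 : q ≤ 3 * p / (3 - p) := by
    rw [le_div_iff₀ (by linarith)]
    nlinarith [mul_lt_mul_of_pos_right hq2 (by linarith : 0 < 3 - p),
      mul_pos (sq_pos_of_pos hp0) (by linarith : 0 < p - 3 / 2)]
  obtain ⟨A, hA, hAu⟩ := exists_lpPow_le_gradPow (by linarith) hp2 hc hq1 hq3
  set r : ℝ := 3 * (q - p) / p with hr
  have hr0 : 0 ≤ r := div_nonneg (by linarith) hp0.le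
  have hr2 : p⁻¹ * r < 2 := by
    rw [hr, inv_mul_eq_div, div_div, div_lt_iff₀ (by positivity)]
    nlinarith
  obtain ⟨B, hB⟩ := bddBelow_mul_sq_sub_mul_rpow (e := b / (2 * p)) (A := 1 / q * (A * 2 ^ r))
    (by positivity) (by positivity) (by positivity : 0 ≤ p⁻¹ * r) hr2
  refine ⟨B - 1 / q * (A * 2 ^ r) * c ^ r, ?_⟩
  rintro _ ⟨u, hu, rfl⟩
  have hG : 0 ≤ gradPow p u := integral_nonneg fun x ↦ by positivity
  set g : ℝ := gradPow p u ^ p⁻¹ with hg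
  have hg0 : 0 ≤ g := by positivity
  have hgr : gradPow p u ^ (p⁻¹ * r) = g ^ r := Real.rpow_mul hG _ _
  have hsum : (g + c) ^ r ≤ 2 ^ r * (g ^ r + c ^ r) := by
    have h1 : g + c ≤ 2 * max g c := by linarith [le_max_left g c, le_max_right g c]
    calc (g + c) ^ r ≤ (2 * max g c) ^ r := by gcongr
      _ = 2 ^ r * max g c ^ r := Real.mul_rpow (by norm_num) (by positivity)
      _ ≤ 2 ^ r * (g ^ r + c ^ r) := by
        gcongr
        rcases max_choice g c with h | h <;> rw [h]
        · exact le_add_of_nonneg_right (by positivity)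
        · exact le_add_of_nonneg_left (by positivity)
  have hl : 1 / q * lpPow q u ≤ 1 / q * (A * (2 ^ r * (g ^ r + c ^ r))) := by
    have := hAu u hu
    gcongr
    exact this.trans (by gcongr)
  have hBu := hB _ hG
  rw [hgr] at hBu
  have hag : 0 ≤ a / p * gradPow p u := by positivity
  unfold Ifun
  linarith

theorem hasFDerivAt_const_mul_comp_smul {v : E3 → ℝ} (hv : Differentiable ℝ v) (k t : ℝ) (x : E3) :
    HasFDerivAt (fun x ↦ k * v (t • x)) ((k * t) • fderiv ℝ v (t • x)) x := by
  have h1 : HasFDerivAt (fun x : E3 ↦ t • x) (t • ContinuousLinearMap.id ℝ E3) x :=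
    (hasFDerivAt_id x).const_smul t
  refine (((hv (t • x)).hasFDerivAt.comp x h1).const_mul k).congr_fderiv ?_
  ext y
  simp [mul_assoc]

theorem abs_const_mul_comp_smul_rpow {k : ℝ} (hk : 0 ≤ k) (v : E3 → ℝ) (t p : ℝ) (x : E3) :
    |k * v (t • x)| ^ p = k ^ p * |v (t • x)| ^ p := by
  rw [abs_mul, abs_of_nonneg hk, Real.mul_rpow hk (abs_nonneg _)]

theorem norm_fderiv_const_mul_comp_smul_rpow {v : E3 → ℝ} (hv : Differentiable ℝ v) {k t : ℝ}
    (hk : 0 ≤ k) (ht : 0 ≤ t) (p : ℝ) (x : E3) :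
    ‖fderiv ℝ (fun x ↦ k * v (t • x)) x‖ ^ p = (k * t) ^ p * ‖fderiv ℝ v (t • x)‖ ^ p := by
  rw [(hasFDerivAt_const_mul_comp_smul hv k t x).fderiv, norm_smul,
    Real.norm_of_nonneg (mul_nonneg hk ht), Real.mul_rpow (mul_nonneg hk ht) (norm_nonneg _)]

theorem lpPow_const_mul_comp_smul {k t : ℝ} (hk : 0 ≤ k) (ht : 0 ≤ t) (p : ℝ) (v : E3 → ℝ) :
    lpPow p (fun x ↦ k * v (t • x)) = k ^ p * (t ^ 3)⁻¹ * lpPow p v := by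
  simp_rw [lpPow, abs_const_mul_comp_smul_rpow hk]
  rw [integral_const_mul,
    Measure.integral_comp_smul_of_nonneg volume (fun x ↦ |v x| ^ p) t (hR := ht)]
  simp [mul_assoc]

theorem gradPow_const_mul_comp_smul {v : E3 → ℝ} (hv : Differentiable ℝ v) {k t : ℝ}
    (hk : 0 ≤ k) (ht : 0 ≤ t) (p : ℝ) :
    gradPow p (fun x ↦ k * v (t • x)) = (k * t) ^ p * (t ^ 3)⁻¹ * gradPow p v := by
  simp_rw [gradPow, norm_fderiv_const_mul_comp_smul_rpow hv hk ht]
  rw [integral_const_mul,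
    Measure.integral_comp_smul_of_nonneg volume (fun x ↦ ‖fderiv ℝ v x‖ ^ p) t (hR := ht)]
  simp [mul_assoc]

theorem Wmem.const_mul_comp_smul {p : ℝ} {v : E3 → ℝ} (hv : Wmem p v) {k t : ℝ}
    (hk : 0 ≤ k) (ht : 0 < t) : Wmem p (fun x ↦ k * v (t • x)) := by
  obtain ⟨hd, hi, hg⟩ := hv
  refine ⟨fun x ↦ (hasFDerivAt_const_mul_comp_smul hd k t x).differentiableAt, ?_, ?_⟩
  · simp_rw [abs_const_mul_comp_smul_rpow hk]
    exact (hi.comp_smul ht.ne').const_mul _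
  · simp_rw [norm_fderiv_const_mul_comp_smul_rpow hd hk ht.le]
    exact (hg.comp_smul ht.ne').const_mul _

theorem exists_Wmem_lpPow_pos {p : ℝ} (hp : 0 < p) : ∃ v, Wmem p v ∧ 0 < lpPow p v := by
  let φ : ContDiffBump (0 : E3) := ⟨1, 2, one_pos, one_lt_two⟩
  have hφ1 : ContDiff ℝ 1 φ := φ.contDiff
  have hcont : Continuous fun x ↦ |φ x| ^ p := φ.continuous.abs.rpow_const fun _ ↦ .inr hp.le
  have hint : Integrable fun x ↦ |φ x| ^ p :=
    hcont.integrable_of_hasCompactSupport (φ.hasCompactSupport.norm.rpow_const hp.ne')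
  refine ⟨φ, ⟨hφ1.differentiable one_ne_zero, hint, ?_⟩, ?_⟩
  · have hc := hφ1.continuous_fderiv one_ne_zero
    exact (hc.norm.rpow_const fun _ ↦ .inr hp.le).integrable_of_hasCompactSupport
      ((φ.hasCompactSupport.fderiv (𝕜 := ℝ)).norm.rpow_const hp.ne')
  · refine integral_pos_of_integrable_nonneg_nonzero (x := 0) hcont hint
      (fun x ↦ by positivity) ?_
    rw [φ.one_of_mem_closedBall (by simpa using φ.rIn_pos.le)]
    simp

theorem Ifun_le_of_gradPow {a b p q : ℝ} (hq : 0 < q) (u : E3 → ℝ) :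
    Ifun a b p q u ≤ a / p * gradPow p u + b / (2 * p) * gradPow p u ^ 2 := by
  have h : 0 ≤ lpPow q u := integral_nonneg fun x ↦ by positivity
  have : 0 ≤ 1 / q * lpPow q u := by positivity
  unfold Ifun
  linarith

theorem exists_mem_Sset_gradPow_eq {p c : ℝ} (hp : 0 < p) (hc : 0 < c) :
    ∃ G : ℝ, ∀ t : ℝ, 0 < t → ∃ u ∈ Sset p c, gradPow p u = t ^ p * G := by
  obtain ⟨v, hv, hL⟩ := exists_Wmem_lpPow_pos hp
  set L := lpPow p v with hL_def
  refine ⟨c ^ p * L⁻¹ * gradPow p v, fun t ht ↦ ?_⟩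
  set k : ℝ := c * (L⁻¹ * t ^ 3) ^ p⁻¹ with hk_def
  have hk : 0 ≤ k := by positivity
  have hkp : k ^ p = c ^ p * (L⁻¹ * t ^ 3) := by
    rw [hk_def, Real.mul_rpow hc.le (by positivity), Real.rpow_inv_rpow (by positivity) hp.ne']
  refine ⟨fun x ↦ k * v (t • x), ⟨hv.const_mul_comp_smul hk ht, ?_⟩, ?_⟩
  · rw [lpPow_const_mul_comp_smul hk ht.le, hkp, ← hL_def]
    field_simp
  · rw [gradPow_const_mul_comp_smul hv.1 hk ht.le, Real.mul_rpow hk ht.le, hkp]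
    field_simp

theorem ifun_nonpos {a b p q c : ℝ} (hp : 0 < p) (hq : 0 < q) (hc : 0 < c)
    (hbdd : BddBelow (Ifun a b p q '' Sset p c)) : ifun a b p q c ≤ 0 := by
  obtain ⟨G, hG⟩ := exists_mem_Sset_gradPow_eq hp hc
  have hpow : Tendsto (fun t : ℝ ↦ t ^ p * G) (nhdsWithin 0 (Ioi 0)) (nhds 0) := by
    have h := (Real.continuousAt_rpow_const 0 p (.inr hp.le)).tendsto
    rw [Real.zero_rpow hp.ne'] at h
    simpa using (h.mono_left nhdsWithin_le_nhds).mul_const G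
  have hlim : Tendsto (fun t : ℝ ↦ a / p * (t ^ p * G) + b / (2 * p) * (t ^ p * G) ^ 2)
      (nhdsWithin 0 (Ioi 0)) (nhds 0) := by
    simpa using (hpow.const_mul (a / p)).add ((hpow.pow 2).const_mul (b / (2 * p)))
  refine ge_of_tendsto hlim ?_
  filter_upwards [self_mem_nhdsWithin] with t ht
  obtain ⟨u, hu, hgu⟩ := hG t ht
  rw [← hgu]
  exact (csInf_le hbdd (mem_image_of_mem _ hu)).trans (Ifun_le_of_gradPow hq u)

theorem stmt7 (a b p q c : ℝ) (ha : 0 < a) (hb : 0 < b) (hc : 0 < c)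
    (hp1 : 3/2 < p) (hp2 : p < 3) (hq1 : p < q) (hq2 : q < p + 2*p^2/3) :
    BddBelow (Ifun a b p q '' Sset p c) ∧ ifun a b p q c ≤ 0 := by
  have hbdd := bddBelow_Ifun_image ha hb hc hp1 hp2 hq1 hq2
  exact ⟨hbdd, ifun_nonpos (by linarith) (by linarith) hc hbdd⟩
end
end

section
/- Let 3/2<p<3, p<q<p+2p^2/3. Then the function c ↦ i(c) is continuous on (0,∞), where i(c) = inf{I(u) : u ∈ W^{1,p}(ℝ^3), |u|_p = c}. -/
open MeasureTheory Real Set Filter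

noncomputable section

/-- The rescaling `x ↦ s * u (r • x)`. -/
def rescale (s r : ℝ) (u : E3 → ℝ) : E3 → ℝ := fun x => s * u (r • x)

lemma fderiv_rescale {u : E3 → ℝ} (hu : Differentiable ℝ u) (s r : ℝ) (x : E3) :
    fderiv ℝ (rescale s r u) x = (s * r) • fderiv ℝ u (r • x) := by
  have h1 : HasFDerivAt (fun y : E3 => r • y) (r • ContinuousLinearMap.id ℝ E3) x :=
    (hasFDerivAt_id x).const_smul r
  have h2 := ((hu (r • x)).hasFDerivAt.comp x h1).const_mul s
  refine HasFDerivAt.fderiv (h2.congr_fderiv ?_)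
  ext v
  simp [mul_assoc]

lemma differentiable_rescale {u : E3 → ℝ} (hu : Differentiable ℝ u) (s r : ℝ) :
    Differentiable ℝ (rescale s r u) :=
  (hu.comp (differentiable_id.const_smul r)).const_mul s

lemma abs_rescale_rpow (u : E3 → ℝ) {s : ℝ} (hs : 0 < s) (r w : ℝ) (x : E3) :
    |rescale s r u x| ^ w = s ^ w * |u (r • x)| ^ w := by
  rw [rescale, abs_mul, abs_of_pos hs, Real.mul_rpow hs.le (abs_nonneg _)]

lemma norm_fderiv_rescale_rpow {u : E3 → ℝ} (hu : Differentiable ℝ u) {s r : ℝ}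
    (hs : 0 < s) (hr : 0 < r) (p : ℝ) (x : E3) :
    ‖fderiv ℝ (rescale s r u) x‖ ^ p = (s * r) ^ p * ‖fderiv ℝ u (r • x)‖ ^ p := by
  rw [fderiv_rescale hu, norm_smul, Real.norm_of_nonneg (by positivity),
    Real.mul_rpow (by positivity) (norm_nonneg _)]

lemma lpPow_rescale (u : E3 → ℝ) {s r : ℝ} (hs : 0 < s) (hr : 0 < r) (w : ℝ) :
    lpPow w (rescale s r u) = s ^ w * r ^ (-3 : ℝ) * lpPow w u := by
  have h := Measure.integral_comp_smul (volume : Measure E3) (fun x => |u x| ^ w) r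
  have h3 : |(r ^ 3)⁻¹| = r ^ (-3 : ℝ) := by
    rw [abs_of_pos (by positivity), Real.rpow_neg hr.le]
    norm_cast
  rw [finrank_euclideanSpace_fin, h3, smul_eq_mul] at h
  simp only [lpPow, abs_rescale_rpow u hs]
  rw [integral_const_mul, h, mul_assoc]

lemma gradPow_rescale {u : E3 → ℝ} (hu : Differentiable ℝ u) {s r : ℝ} (hs : 0 < s)
    (hr : 0 < r) (p : ℝ) :
    gradPow p (rescale s r u) = (s * r) ^ p * r ^ (-3 : ℝ) * gradPow p u := by
  have h := Measure.integral_comp_smul (volume : Measure E3) (fun x => ‖fderiv ℝ u x‖ ^ p) r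
  have h3 : |(r ^ 3)⁻¹| = r ^ (-3 : ℝ) := by
    rw [abs_of_pos (by positivity), Real.rpow_neg hr.le]
    norm_cast
  rw [finrank_euclideanSpace_fin, h3, smul_eq_mul] at h
  simp only [gradPow, norm_fderiv_rescale_rpow hu hs hr]
  rw [integral_const_mul, h, mul_assoc]

lemma Wmem.rescale {p : ℝ} {u : E3 → ℝ} (hu : Wmem p u) {s r : ℝ} (hs : 0 < s) (hr : 0 < r) :
    Wmem p (rescale s r u) := by
  refine ⟨differentiable_rescale hu.1 s r, ?_, ?_⟩
  · simp only [abs_rescale_rpow u hs]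
    exact (hu.2.1.comp_smul hr.ne').const_mul _
  · simp only [norm_fderiv_rescale_rpow hu.1 hs hr]
    exact (hu.2.2.comp_smul hr.ne').const_mul _

/-- A rescaling multiplying the `L^p` norm by `t` and preserving `gradPow p`. -/
lemma exists_rescale_mass {p q c t : ℝ} (hp : 0 < p) (hc : 0 < c) (ht : 0 < t) {u : E3 → ℝ}
    (hu : u ∈ Sset p c) :
    ∃ v ∈ Sset p (t * c), gradPow p v = gradPow p u ∧
      lpPow q v = t ^ (q * (1 - 3 / p) + 3) * lpPow q u := by
  have hs : 0 < t ^ (1 - 3 / p) := by positivity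
  have hr : 0 < t⁻¹ := by positivity
  have h3 : t⁻¹ ^ (-3 : ℝ) = t ^ (3 : ℝ) := by
    rw [Real.inv_rpow ht.le, ← Real.rpow_neg ht.le, neg_neg]
  refine ⟨rescale (t ^ (1 - 3 / p)) t⁻¹ u, ⟨hu.1.rescale hs hr, ?_⟩, ?_, ?_⟩
  · rw [lpPow_rescale u hs hr, hu.2, h3, ← Real.rpow_mul ht.le, ← Real.rpow_add ht,
      Real.mul_rpow ht.le hc.le]
    congr 2
    field_simp
    ring
  · rw [gradPow_rescale hu.1.1 hs hr, h3, ← Real.rpow_neg_one t, ← Real.rpow_add ht,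
      ← Real.rpow_mul ht.le, ← Real.rpow_add ht]
    have : (1 - 3 / p + -1) * p + 3 = 0 := by
      field_simp
      ring
    rw [this, Real.rpow_zero, one_mul]
  · rw [lpPow_rescale u hs hr, h3, ← Real.rpow_mul ht.le, ← Real.rpow_add ht]
    congr 2
    ring

/-- A rescaling preserving the `L^p` norm and multiplying `gradPow p` by `r ^ p`. -/
lemma exists_rescale_grad {p q c r : ℝ} (hp : 0 < p) (hr : 0 < r) {u : E3 → ℝ}
    (hu : u ∈ Sset p c) :
    ∃ v ∈ Sset p c, gradPow p v = r ^ p * gradPow p u ∧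
      lpPow q v = r ^ (3 * (q - p) / p) * lpPow q u := by
  have hs : 0 < r ^ (3 / p) := by positivity
  refine ⟨rescale (r ^ (3 / p)) r u, ⟨hu.1.rescale hs hr, ?_⟩, ?_, ?_⟩
  · rw [lpPow_rescale u hs hr, hu.2, ← Real.rpow_mul hr.le, ← Real.rpow_add hr]
    have : 3 / p * p + -3 = 0 := by
      field_simp
      ring
    rw [this, Real.rpow_zero, one_mul]
  · rw [gradPow_rescale hu.1.1 hs hr, Real.mul_rpow hs.le hr.le, ← Real.rpow_mul hr.le,
      ← Real.rpow_add hr, ← Real.rpow_add hr]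
    congr 2
    field_simp
    ring
  · rw [lpPow_rescale u hs hr, ← Real.rpow_mul hr.le, ← Real.rpow_add hr]
    congr 2
    field_simp
    ring

/-- The energy with the `L^q` term weighted by `τ`. -/
def weightedEnergy (a b p q τ : ℝ) (u : E3 → ℝ) : ℝ :=
  a / p * gradPow p u + b / (2 * p) * (gradPow p u) ^ 2 - τ * (1 / q * lpPow q u)

lemma image_Ifun_Sset (a b : ℝ) {p q c : ℝ} (hp : 0 < p) (hc : 0 < c) :
    Ifun a b p q '' Sset p c =
      weightedEnergy a b p q (c ^ (q * (1 - 3 / p) + 3)) '' Sset p 1 := by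
  ext y
  constructor
  · rintro ⟨u, hu, rfl⟩
    obtain ⟨v, hv, hG, hB⟩ := exists_rescale_mass (q := q) hp hc (inv_pos.2 hc) hu
    rw [inv_mul_cancel₀ hc.ne'] at hv
    refine ⟨v, hv, ?_⟩
    have hpos : 0 < c ^ (q * (1 - 3 / p) + 3) := by positivity
    rw [weightedEnergy, Ifun, hG, hB, Real.inv_rpow hc.le]
    field_simp
  · rintro ⟨u, hu, rfl⟩
    obtain ⟨v, hv, hG, hB⟩ := exists_rescale_mass (q := q) hp one_pos hc hu
    rw [mul_one] at hv
    refine ⟨v, hv, ?_⟩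
    rw [weightedEnergy, Ifun, hG, hB]
    ring

/-- In the mass-subcritical range, boundedness below does not depend on the weight. -/
lemma bddBelow_weightedEnergy {a b p q c τ₀ τ : ℝ} (hb : 0 < b) (hp : 0 < p)
    (hq : 3 * (q - p) / p < 2 * p) (hτ₀ : 0 < τ₀) (hτ : 0 < τ)
    (h : BddBelow (weightedEnergy a b p q τ₀ '' Sset p c)) :
    BddBelow (weightedEnergy a b p q τ '' Sset p c) := by
  obtain ⟨m, hm⟩ := h
  set d := 3 * (q - p) / p with hd
  set r := (τ₀ / (2 * τ)) ^ (1 / (2 * p - d)) with hr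
  have hrpos : 0 < r := by positivity
  have hrd : r ^ (2 * p) = τ₀ / (2 * τ) * r ^ d := by
    have : r ^ (2 * p - d) = τ₀ / (2 * τ) := by
      rw [hr, ← Real.rpow_mul (by positivity), one_div_mul_cancel (by linarith),
        Real.rpow_one]
    rw [← this, ← Real.rpow_add hrpos, sub_add_cancel]
  have hrd0 : 0 < r ^ d := by positivity
  set k := τ / (τ₀ * r ^ d) with hk
  have hk0 : 0 < k := by positivity
  set β := b / (2 * p) with hβ
  have hβ0 : 0 < β := by positivity
  set e := a / p * (1 - k * r ^ p) with he
  refine ⟨k * m - e ^ 2 / (2 * β), ?_⟩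
  rintro _ ⟨u, hu, rfl⟩
  obtain ⟨v, hv, hG, hB⟩ := exists_rescale_grad (q := q) hp hrpos hu
  have hle := mul_le_mul_of_nonneg_left (hm ⟨v, hv, rfl⟩) hk0.le
  have hsq : (r ^ p) ^ 2 = τ₀ / (2 * τ) * r ^ d := by
    rw [← hrd, ← Real.rpow_natCast, ← Real.rpow_mul hrpos.le]
    congr 1
    push_cast
    ring
  rw [weightedEnergy, hG, hB] at hle
  rw [weightedEnergy]
  set G := gradPow p u
  set B := 1 / q * lpPow q u with hBdef
  have hkτ : k * (τ₀ * r ^ d) = τ := by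
    rw [hk]
    field_simp
  have hk2 : k * (r ^ p) ^ 2 = 1 / 2 := by
    rw [hsq, hk]
    field_simp
  have hexp : k * (a / p * (r ^ p * G) + β * (r ^ p * G) ^ 2
      - τ₀ * (1 / q * (r ^ d * lpPow q u))) =
      a / p * G - e * G + 1 / 2 * (β * G ^ 2) - τ * B := by
    rw [← hkτ, ← hk2, he, hBdef]
    ring
  rw [hexp] at hle
  have hsquare : 0 ≤ e * G + β / 2 * G ^ 2 + e ^ 2 / (2 * β) := by
    have : e * G + β / 2 * G ^ 2 + e ^ 2 / (2 * β) = (β * G + e) ^ 2 / (2 * β) := by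
      field_simp
      ring
    rw [this]
    positivity
  linarith

lemma concaveOn_sInf_weightedEnergy {a b p q : ℝ} {S : Set (E3 → ℝ)} (hS : S.Nonempty)
    (h : ∀ τ, 0 < τ → BddBelow (weightedEnergy a b p q τ '' S)) :
    ConcaveOn ℝ (Ioi 0) (fun τ => sInf (weightedEnergy a b p q τ '' S)) := by
  refine ⟨convex_Ioi 0, fun x hx y hy s t hs ht hst => ?_⟩
  refine le_csInf (hS.image _) ?_
  rintro _ ⟨u, hu, rfl⟩
  have h1 := mul_le_mul_of_nonneg_left (csInf_le (h x hx) (mem_image_of_mem _ hu)) hs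
  have h2 := mul_le_mul_of_nonneg_left (csInf_le (h y hy) (mem_image_of_mem _ hu)) ht
  have h3 : weightedEnergy a b p q (s • x + t • y) u =
      s * weightedEnergy a b p q x u + t * weightedEnergy a b p q y u := by
    obtain rfl : t = 1 - s := by linarith
    simp only [weightedEnergy, smul_eq_mul]
    ring
  rw [h3]
  exact add_le_add h1 h2

lemma continuousOn_sInf_weightedEnergy {a b p q c : ℝ} (hb : 0 < b) (hp : 0 < p)
    (hq : 3 * (q - p) / p < 2 * p) :
    ContinuousOn (fun τ => sInf (weightedEnergy a b p q τ '' Sset p c)) (Ioi 0) := by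
  rcases (Sset p c).eq_empty_or_nonempty with hS | hS
  · simp only [hS, image_empty]
    exact continuousOn_const
  by_cases h : ∃ τ, 0 < τ ∧ BddBelow (weightedEnergy a b p q τ '' Sset p c)
  · obtain ⟨τ₀, hτ₀, h⟩ := h
    exact (concaveOn_sInf_weightedEnergy hS fun τ hτ =>
      bddBelow_weightedEnergy hb hp hq hτ₀ hτ h).continuousOn isOpen_Ioi
  · push Not at h
    exact continuousOn_const.congr fun τ hτ => Real.sInf_of_not_bddBelow (h τ hτ)

theorem stmt11 (a b p q : ℝ) (ha : 0 < a) (hb : 0 < b)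
    (hp1 : 3/2 < p) (hp2 : p < 3) (hq1 : p < q) (hq2 : q < p + 2*p^2/3) :
    ContinuousOn (fun c => ifun a b p q c) (Set.Ioi 0) := by
  have hp : 0 < p := by linarith
  have hq : 3 * (q - p) / p < 2 * p := by
    rw [div_lt_iff₀ hp]
    nlinarith
  have hpow : ContinuousOn (fun c : ℝ => c ^ (q * (1 - 3 / p) + 3)) (Ioi 0) :=
    continuousOn_id.rpow_const fun c hc => Or.inl (ne_of_gt hc)
  have hmaps : MapsTo (fun c : ℝ => c ^ (q * (1 - 3 / p) + 3)) (Ioi 0) (Ioi 0) :=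
    fun c hc => Real.rpow_pos_of_pos hc _
  refine ((continuousOn_sInf_weightedEnergy (a := a) (c := 1) hb hp hq).comp hpow hmaps).congr ?_
  intro c hc
  simp only [ifun, image_Ifun_Sset a b hp hc, Function.comp_apply]
end
end
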